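/- arXiv:2402.11205 — 3 statements merged into one kernel-verified Lean document; each statement's English description precedes it below -/
import Mathlib

section
/- For all p q : Fin n with p ≠ q and every occupation string b : Fin n → Bool with b q = true and b p = false, one has a†_p (a_q |b⟩) = (−1)^{card {k | min p q < k ∧ k < max p q ∧ b k = true}} • |Function.update (Function.update b q false) p true⟩; in particular the resulting occupation string has its p-th bit equal to true and its q-th bit equal to false. -/
/-- The fermionic Fock space on `n` modes: the free `ℂ`-module on occupation strings. -/
abbrev FockSpace (n : ℕ) : Type := (Fin n → Bool) →₀ ℂ

/-- The basis vector `|b⟩` indexed by the occupation string `b`. -/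
noncomputable def fket {n : ℕ} (b : Fin n → Bool) : FockSpace n := Finsupp.single b 1

/-- The annihilation operator `a_q` in the Jordan–Wigner representation:
`a_q |b⟩ = 0` if `b q = false`, and
`a_q |b⟩ = (-1)^(card {k | k < q ∧ b k = true}) • |update b q false⟩` if `b q = true`. -/
noncomputable def ann (n : ℕ) (q : Fin n) : FockSpace n →ₗ[ℂ] FockSpace n :=
  Finsupp.lsum ℂ fun b =>
    if b q = true then
      ((-1 : ℂ) ^ (Finset.univ.filter fun k => k < q ∧ b k = true).card) •
        Finsupp.lsingle (Function.update b q false)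
    else 0

/-- The creation operator `a†_p` in the Jordan–Wigner representation:
`a†_p |b⟩ = 0` if `b p = true`, and
`a†_p |b⟩ = (-1)^(card {k | k < p ∧ b k = true}) • |update b p true⟩` if `b p = false`. -/
noncomputable def cre (n : ℕ) (p : Fin n) : FockSpace n →ₗ[ℂ] FockSpace n :=
  Finsupp.lsum ℂ fun b =>
    if b p = true then 0
    else
      ((-1 : ℂ) ^ (Finset.univ.filter fun k => k < p ∧ b k = true).card) •
        Finsupp.lsingle (Function.update b p true)

theorem ann_fket_of_true {n : ℕ} {q : Fin n} {b : Fin n → Bool} (hq : b q = true) :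
    ann n q (fket b) =
      ((-1 : ℂ) ^ (Finset.univ.filter fun k => k < q ∧ b k = true).card) •
        fket (Function.update b q false) := by
  simp [ann, fket, hq]

theorem cre_fket_of_false {n : ℕ} {p : Fin n} {b : Fin n → Bool} (hp : b p = false) :
    cre n p (fket b) =
      ((-1 : ℂ) ^ (Finset.univ.filter fun k => k < p ∧ b k = true).card) •
        fket (Function.update b p true) := by
  simp [cre, fket, hp]

/-- The occupied modes below `j` split at an empty mode `i < j`. -/
theorem card_occupied_lt_eq_add {α : Type*} [Fintype α] [LinearOrder α] {i j : α} (hij : i < j)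
    {b : α → Bool} (hi : b i = false) :
    (Finset.univ.filter fun k => k < j ∧ b k = true).card =
      (Finset.univ.filter fun k => k < i ∧ b k = true).card +
        (Finset.univ.filter fun k => i < k ∧ k < j ∧ b k = true).card := by
  rw [← Finset.card_union_of_disjoint]
  · congr 1
    ext k
    simp only [Finset.mem_filter, Finset.mem_univ, true_and, Finset.mem_union]
    grind
  · rw [Finset.disjoint_filter]
    exact fun k _ hk hk' => lt_asymm hk.1 hk'.1

theorem cre_ann_of_valid (n : ℕ) (p q : Fin n) (hpq : p ≠ q) (b : Fin n → Bool)
    (hq : b q = true) (hp : b p = false) :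
    cre n p (ann n q (fket b)) =
      ((-1 : ℂ) ^ (Finset.univ.filter
          fun k => min p q < k ∧ k < max p q ∧ b k = true).card) •
        fket (Function.update (Function.update b q false) p true) ∧
    Function.update (Function.update b q false) p true p = true ∧
    Function.update (Function.update b q false) p true q = false := by
  refine ⟨?_, by simp, by simp [hpq.symm]⟩
  rw [ann_fket_of_true hq, map_smul, cre_fket_of_false (by simp [hpq, hp]), smul_smul, ← pow_add]
  congr 1
  have below (r : Fin n) (hr : r ≤ q) :
      (Finset.univ.filter fun k => k < r ∧ Function.update b q false k = true) =
        Finset.univ.filter fun k => k < r ∧ b k = true :=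
    Finset.filter_congr fun k _ => and_congr_right fun hk => by
      rw [Function.update_of_ne (hk.trans_le hr).ne]
  rcases hpq.lt_or_gt with h | h
  · rw [below p h.le, card_occupied_lt_eq_add h hp, min_eq_left h.le, max_eq_right h.le,
      add_right_comm, pow_add, Even.neg_one_pow ⟨_, rfl⟩, one_mul]
  · have above :
        (Finset.univ.filter fun k => q < k ∧ k < p ∧ Function.update b q false k = true) =
          Finset.univ.filter fun k => q < k ∧ k < p ∧ b k = true :=
      Finset.filter_congr fun k _ => and_congr_right fun hk => by
        rw [Function.update_of_ne hk.ne']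
    rw [card_occupied_lt_eq_add h (Function.update_self q false b), below q le_rfl, above,
      min_eq_right h.le, max_eq_left h.le, ← add_assoc, pow_add, Even.neg_one_pow ⟨_, rfl⟩,
      one_mul]
end

section
/- Let L N : ℕ, let P : Fin L → Fin N → Prop be a decidable validity predicate and c : Fin N → Fin L → Fin N a row-index function. Work with matrices indexed by Fin 2 × Fin L × Fin N with standard basis vectors e(v, ℓ, j) (validation, selection, Fock registers). Suppose U : Fin L → Matrix ((Fin 2 × Fin L × Fin N)) ((Fin 2 × Fin L × Fin N)) ℂ satisfies: (i) for every i : Fin L and j with P i j, U i *ᵥ e(1, i, j) = e(0, i, c j i); and (ii) U i *ᵥ e(v, ℓ, j) = e(v, ℓ, j) whenever it is not the case that v = 1, ℓ = i and P i j. Define O_c := U_{L−1} * ⋯ * U_1 * U_0 * (X ⊗ I_L ⊗ I_N), where X := !![0, 1; 1, 0] (so the NOT gate acts first, followed by U_0, …, U_{L−1} in circuit order). Then for all ℓ : Fin L and j : Fin N: O_c *ᵥ e(0, ℓ, j) = e(0, ℓ, c j ℓ) if P ℓ j, and O_c *ᵥ e(0, ℓ, j) = e(1, ℓ, j) otherwise.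 -/
open Matrix Kronecker

/-- The standard basis column vector with a 1 in position `x`. -/
noncomputable def ket {ι : Type*} [DecidableEq ι] (x : ι) : ι → ℂ := Pi.single x 1

section ListProd

variable {n ι R : Type*} [Fintype n] [DecidableEq n] [CommSemiring R]

theorem Matrix.reverse_prod_mulVec_of_forall_fixed (U : ι → Matrix n n R) (v : n → R)
    (l : List ι) (h : ∀ i ∈ l, U i *ᵥ v = v) : (l.map U).reverse.prod *ᵥ v = v := by
  induction l with
  | nil => simp
  | cons i l ih =>
    rw [List.forall_mem_cons] at h
    simp [← mulVec_mulVec, h.1, ih h.2]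

theorem Matrix.reverse_prod_mulVec_of_mem (U : ι → Matrix n n R) {v w : n → R} {a : ι}
    (ha : U a *ᵥ v = w) (hv : ∀ i, i ≠ a → U i *ᵥ v = v) (hw : ∀ i, U i *ᵥ w = w)
    (l : List ι) (hl : a ∈ l) : (l.map U).reverse.prod *ᵥ v = w := by
  induction l with
  | nil => simp at hl
  | cons i l ih =>
    simp only [List.map_cons, List.reverse_cons, List.prod_append, List.prod_singleton,
      ← mulVec_mulVec]
    by_cases hi : i = a
    · rw [hi, ha]
      exact reverse_prod_mulVec_of_forall_fixed U w l fun i _ => hw i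
    · rw [hv i hi]
      exact ih ((List.mem_cons.mp hl).resolve_left (Ne.symm hi))

end ListProd

theorem not_kronecker_one_mulVec_ket_zero {L N : ℕ} (ℓ : Fin L) (j : Fin N) :
    ((!![0, 1; 1, 0] : Matrix (Fin 2) (Fin 2) ℂ) ⊗ₖ
      ((1 : Matrix (Fin L) (Fin L) ℂ) ⊗ₖ (1 : Matrix (Fin N) (Fin N) ℂ))) *ᵥ
      ket ((0 : Fin 2), ℓ, j) = ket ((1 : Fin 2), ℓ, j) := by
  rw [one_kronecker_one]
  ext ⟨v, x⟩
  fin_cases v <;> simp [ket, Pi.single_apply, one_apply]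

theorem Oc_from_Ul_blocks (L N : ℕ)
    (P : Fin L → Fin N → Prop) [∀ i j, Decidable (P i j)]
    (c : Fin N → Fin L → Fin N)
    (U : Fin L → Matrix (Fin 2 × Fin L × Fin N) (Fin 2 × Fin L × Fin N) ℂ)
    (hU_act : ∀ (i : Fin L) (j : Fin N), P i j →
      U i *ᵥ ket ((1 : Fin 2), i, j) = ket ((0 : Fin 2), i, c j i))
    (hU_id : ∀ (i : Fin L) (v : Fin 2) (ℓ : Fin L) (j : Fin N),
      ¬ (v = 1 ∧ ℓ = i ∧ P i j) → U i *ᵥ ket (v, ℓ, j) = ket (v, ℓ, j))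
    (Oc : Matrix (Fin 2 × Fin L × Fin N) (Fin 2 × Fin L × Fin N) ℂ)
    (hOc : Oc = (List.ofFn U).reverse.prod *
      ((!![0, 1; 1, 0] : Matrix (Fin 2) (Fin 2) ℂ) ⊗ₖ
        ((1 : Matrix (Fin L) (Fin L) ℂ) ⊗ₖ (1 : Matrix (Fin N) (Fin N) ℂ)))) :
    ∀ (ℓ : Fin L) (j : Fin N),
      (P ℓ j → Oc *ᵥ ket ((0 : Fin 2), ℓ, j) = ket ((0 : Fin 2), ℓ, c j ℓ)) ∧
      (¬ P ℓ j → Oc *ᵥ ket ((0 : Fin 2), ℓ, j) = ket ((1 : Fin 2), ℓ, j)) := by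
  intro ℓ j
  rw [hOc, List.ofFn_eq_map, ← mulVec_mulVec, not_kronecker_one_mulVec_ket_zero]
  refine ⟨fun hP => ?_, fun hP => ?_⟩
  · exact reverse_prod_mulVec_of_mem U (hU_act ℓ j hP)
      (fun i hi => hU_id i 1 ℓ j fun h => hi h.2.1.symm)
      (fun i => hU_id i 0 ℓ (c j ℓ) fun h => zero_ne_one h.1) _ (List.mem_finRange ℓ)
  · refine reverse_prod_mulVec_of_forall_fixed U _ _ fun i _ => hU_id i 1 ℓ j ?_
    rintro ⟨-, rfl, h⟩
    exact hP h
end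

section
/- Let m N : ℕ and s = 2^m, with the selection register indexed by bit strings (Fin m → Fin 2). Let P be a decidable predicate on selection indices ℓ and Fock indices j, and c : Fin N → (Fin m → Fin 2) → Fin N. Suppose O_c is a matrix indexed by Fin 2 × (Fin m → Fin 2) × Fin N satisfying, for all ℓ, j: O_c *ᵥ e(0, ℓ, j) = e(0, ℓ, c j ℓ) if P ℓ j, and O_c *ᵥ e(0, ℓ, j) = e(1, ℓ, j) otherwise. Then for all i j : Fin N: ⟨e(0, 0ᵐ, i), (I₂ ⊗ D_m ⊗ I_N) * O_c * (I₂ ⊗ D_m ⊗ I_N) *ᵥ e(0, 0ᵐ, j)⟩ = (1/2^m) · card {ℓ | P ℓ j ∧ c j ℓ = i}. -/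
open Matrix Kronecker

/-- The 2×2 Hadamard matrix `H = (1/√2) !![1, 1; 1, -1]` over `ℂ`. -/
noncomputable def Hmat : Matrix (Fin 2) (Fin 2) ℂ :=
  ((Real.sqrt 2 : ℂ))⁻¹ • !![1, 1; 1, -1]

/-- The `m`-fold Kronecker power of the Hadamard matrix, indexed by bit strings,
with entries `D_m x y = ∏ k, H (x k) (y k)`. -/
noncomputable def Dm (m : ℕ) : Matrix (Fin m → Fin 2) (Fin m → Fin 2) ℂ :=
  fun x y => ∏ k, Hmat (x k) (y k)

lemma star_ket_dotProduct_mulVec_ket {ι : Type*} [Fintype ι] [DecidableEq ι]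
    (A : Matrix ι ι ℂ) (x y : ι) : star (ket x) ⬝ᵥ (A *ᵥ ket y) = A x y := by
  simp [ket]

lemma mulVec_ket_apply {ι : Type*} [Fintype ι] [DecidableEq ι]
    (A : Matrix ι ι ℂ) (x y : ι) : (A *ᵥ ket y) x = A x y := by
  simp [ket]

lemma Dm_zero_left (m : ℕ) (y : Fin m → Fin 2) :
    Dm m (fun _ => 0) y = ((Real.sqrt 2 : ℂ))⁻¹ ^ m := by
  have h (b : Fin 2) : Hmat 0 b = ((Real.sqrt 2 : ℂ))⁻¹ := by
    fin_cases b <;> simp [Hmat]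
  simp [Dm, h]

lemma Dm_zero_right (m : ℕ) (x : Fin m → Fin 2) :
    Dm m x (fun _ => 0) = ((Real.sqrt 2 : ℂ))⁻¹ ^ m := by
  have h (b : Fin 2) : Hmat b 0 = ((Real.sqrt 2 : ℂ))⁻¹ := by
    fin_cases b <;> simp [Hmat]
  simp [Dm, h]

lemma inv_sqrt_two_pow_mul_self (m : ℕ) :
    ((Real.sqrt 2 : ℂ))⁻¹ ^ m * ((Real.sqrt 2 : ℂ))⁻¹ ^ m = 1 / 2 ^ m := by
  have h : (Real.sqrt 2 : ℂ) * Real.sqrt 2 = 2 := by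
    exact_mod_cast Real.mul_self_sqrt (by norm_num : (0 : ℝ) ≤ 2)
  rw [← mul_pow, ← mul_inv, h, inv_pow, one_div]

theorem diffusion_Oc_diffusion_entry (m N : ℕ)
    (P : (Fin m → Fin 2) → Fin N → Prop) [∀ ℓ j, Decidable (P ℓ j)]
    (c : Fin N → (Fin m → Fin 2) → Fin N)
    (Oc : Matrix (Fin 2 × (Fin m → Fin 2) × Fin N) (Fin 2 × (Fin m → Fin 2) × Fin N) ℂ)
    (hOc : ∀ (ℓ : Fin m → Fin 2) (j : Fin N),
      (P ℓ j → Oc *ᵥ ket ((0 : Fin 2), ℓ, j) = ket ((0 : Fin 2), ℓ, c j ℓ)) ∧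
      (¬ P ℓ j → Oc *ᵥ ket ((0 : Fin 2), ℓ, j) = ket ((1 : Fin 2), ℓ, j))) :
    ∀ i j : Fin N,
      star (ket ((0 : Fin 2), (fun _ => 0 : Fin m → Fin 2), i)) ⬝ᵥ
        ((((1 : Matrix (Fin 2) (Fin 2) ℂ) ⊗ₖ (Dm m ⊗ₖ (1 : Matrix (Fin N) (Fin N) ℂ))) *
            Oc *
            ((1 : Matrix (Fin 2) (Fin 2) ℂ) ⊗ₖ (Dm m ⊗ₖ (1 : Matrix (Fin N) (Fin N) ℂ)))) *ᵥ
          ket ((0 : Fin 2), (fun _ => 0 : Fin m → Fin 2), j)) =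
      (1 / 2 ^ m : ℂ) *
        ((Finset.univ.filter fun ℓ : Fin m → Fin 2 => P ℓ j ∧ c j ℓ = i).card : ℂ) := by
  intro i j
  have hentry (ℓ' ℓ : Fin m → Fin 2) : Oc (0, ℓ', i) (0, ℓ, j) =
      if ℓ' = ℓ then (if P ℓ j ∧ c j ℓ = i then 1 else 0) else 0 := by
    rw [← mulVec_ket_apply Oc]
    by_cases hP : P ℓ j
    · rw [(hOc ℓ j).1 hP]
      simp [ket, Pi.single_apply, hP, ite_and, eq_comm]
    · rw [(hOc ℓ j).2 hP]
      simp [ket, hP]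
  rw [star_ket_dotProduct_mulVec_ket, Finset.natCast_card_filter, Finset.mul_sum]
  simp only [mul_apply, Fintype.sum_prod_type, kroneckerMap_apply, one_apply, mul_ite, ite_mul,
    mul_one, one_mul, mul_zero, zero_mul, Dm_zero_left, Dm_zero_right, Finset.sum_ite_eq,
    Finset.sum_ite_eq', Finset.mem_univ, if_true]
  have hscale := inv_sqrt_two_pow_mul_self m
  rw [inv_pow, one_div] at hscale
  simp [hentry, hscale]
end
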